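/- For every n ≥ 2 and every m ∈ ℕ, lim_{θ → 0⁺} Θ(m, θ, n-1) = N_m(S^{n-1}). -/

import Mathlib

open MeasureTheory Metric Filter
open scoped ENNReal RealInnerProductSpace

noncomputable section

abbrev E (n : ℕ) : Type := EuclideanSpace ℝ (Fin n)

/-- The standard surface measure on the unit sphere `S^{n-1}`, as a Borel measure on `ℝⁿ`. -/
def sphMeasure (n : ℕ) : Measure (E n) :=
  Measure.map Subtype.val ((volume : Measure (E n)).toSphere)

/-- `|S^{n-1}|` : the total mass of the surface measure. -/
def SA (n : ℕ) : ℝ := (sphMeasure n Set.univ).toReal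

/-- `P̊_m` : polynomials of degree at most `m` with zero mean on the sphere. -/
def P0 (n m : ℕ) : Set (MvPolynomial (Fin n) ℝ) :=
  {p | p.totalDegree ≤ m ∧ ∫ x, MvPolynomial.eval (fun i => x i) p ∂(sphMeasure n) = 0}

/-- `Θ(m, θ, n-1)` : the infimum of `Σ_i ν_iᶿ` over all probability measures
`ν = Σ_i ν_i δ_{ξ_i}` on `S^{n-1}` supported on countably many points such that
`∫ p dν = 0` for all `p ∈ P̊_m`. -/
def Theta (n m : ℕ) (θ : ℝ) : ℝ :=
  sInf {t : ℝ | ∃ (ξ : ℕ → E n) (w : ℕ → ℝ),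
    (∀ i, ξ i ∈ Metric.sphere (0 : E n) 1) ∧ (∀ i, 0 ≤ w i) ∧ Summable w ∧
    (∑' i, w i) = 1 ∧
    (∀ p ∈ P0 n m, (∑' i, w i * MvPolynomial.eval (fun j => ξ i j) p) = 0) ∧
    Summable (fun i => w i ^ θ) ∧ t = ∑' i, w i ^ θ}

/-- `N_m(S^{n-1})` : the smallest `N` for which there are `N` points on the sphere and
nonnegative weights summing to `1` whose weighted sums annihilate every `p ∈ P̊_m`. -/
def Nsph (n m : ℕ) : ℕ :=
  sInf {N : ℕ | ∃ (x : Fin N → E n) (w : Fin N → ℝ),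
    (∀ i, x i ∈ Metric.sphere (0 : E n) 1) ∧ (∀ i, 0 ≤ w i) ∧ (∑ i, w i) = 1 ∧
    ∀ p ∈ P0 n m, (∑ i, w i * MvPolynomial.eval (fun j => x i j) p) = 0}


lemma isCompact_convexHull_fd {V : Type*} [NormedAddCommGroup V] [NormedSpace ℝ V]
    [FiniteDimensional ℝ V] {s : Set V} (hs : IsCompact s) : IsCompact (convexHull ℝ s) := by
  set D := Module.finrank ℝ V + 1 with hD
  have hK : IsCompact ((stdSimplex ℝ (Fin D)) ×ˢ (Set.univ.pi (fun _ : Fin D => s))) :=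
    (isCompact_stdSimplex ℝ (Fin D)).prod (isCompact_univ_pi fun _ => hs)
  have hc : Continuous (fun q : (Fin D → ℝ) × (Fin D → V) => ∑ i, q.1 i • q.2 i) := by fun_prop
  convert hK.image hc using 1
  ext v
  constructor
  · intro hv
    obtain ⟨ι, _, z, w, hz, hi, hw, h1, hv⟩ := eq_pos_convex_span_of_mem_convexHull hv
    have hcard : Fintype.card ι ≤ Fintype.card (Fin D) := by
      rw [Fintype.card_fin]
      exact hi.card_le_finrank_succ.trans (Nat.succ_le_succ (Submodule.finrank_le _))
    obtain ⟨e⟩ := Function.Embedding.nonempty_of_card_le hcard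
    have hne : Nonempty ι := by
      by_contra hne
      rw [not_nonempty_iff] at hne
      simp at h1
    obtain ⟨i0⟩ := hne
    refine ⟨(Function.extend e w 0, Function.extend e z (fun _ => z i0)), ⟨⟨?_, ?_⟩, ?_⟩, ?_⟩
    · intro j
      by_cases hj : ∃ i, e i = j
      · obtain ⟨i, rfl⟩ := hj
        simpa [e.injective.extend_apply] using (hw i).le
      · simp [Function.extend_apply' _ _ _ hj]
    · rw [← h1]
      refine (Fintype.sum_of_injective e e.injective _ _ ?_ ?_).symm
      · intro j hj
        simp [Function.extend_apply' _ _ _ hj]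
      · intro i
        simp [e.injective.extend_apply]
    · intro j _
      by_cases hj : ∃ i, e i = j
      · obtain ⟨i, rfl⟩ := hj
        simpa [e.injective.extend_apply] using hz ⟨i, rfl⟩
      · simpa [Function.extend_apply' _ _ _ hj] using hz ⟨i0, rfl⟩
    · rw [← hv]
      refine (Fintype.sum_of_injective e e.injective _ _ ?_ ?_).symm
      · intro j hj
        simp [Function.extend_apply' _ _ _ hj]
      · intro i
        simp [e.injective.extend_apply]
  · rintro ⟨⟨w, z⟩, ⟨hw, hz⟩, rfl⟩
    exact mem_convexHull_of_exists_fintype w z hw.1 hw.2 (fun i => hz i trivial) rfl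

abbrev Idx (n m : ℕ) : Type := {a : Fin n →₀ ℕ // a.degree ≤ m}

instance (n m : ℕ) : Finite (Idx n m) := (Finsupp.finite_of_degree_le (σ := Fin n) m).to_subtype

instance (n m : ℕ) : Fintype (Idx n m) := Fintype.ofFinite _

def Phi (n m : ℕ) (x : E n) : Idx n m → ℝ := fun a => ∏ i, x i ^ (a.1 i)

lemma Phi_cont (n m : ℕ) : Continuous (Phi n m) := by
  unfold Phi
  fun_prop

lemma Phi_le (n m : ℕ) (x : E n) (hx : x ∈ sphere (0 : E n) 1) (a : Idx n m) :
    |Phi n m x a| ≤ 1 := by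
  unfold Phi
  rw [Finset.abs_prod]
  refine Finset.prod_le_one (fun i _ => abs_nonneg _) (fun i _ => ?_)
  rw [abs_pow]
  refine pow_le_one₀ (abs_nonneg _) ?_
  have h1 : ‖x‖ = 1 := by simpa using hx
  have := PiLp.norm_apply_le x i
  rw [h1] at this
  simpa using this

lemma eval_Phi (n m : ℕ) (p : MvPolynomial (Fin n) ℝ) (hp : p.totalDegree ≤ m) (x : E n) :
    MvPolynomial.eval (fun i => x i) p = ∑ a : Idx n m, p.coeff a.1 * Phi n m x a := by
  classical
  rw [MvPolynomial.eval_eq']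
  have hf := Finsupp.finite_of_degree_le (σ := Fin n) m
  have h1 : p.support ⊆ hf.toFinset := by
    intro d hd
    simp only [Set.Finite.mem_toFinset]
    exact (MvPolynomial.le_totalDegree hd).trans hp
  rw [Finset.sum_subset h1]
  · unfold Phi
    exact Finset.sum_subtype (p := fun a : Fin n →₀ ℕ => a.degree ≤ m) _ (by simp)
      (fun d => p.coeff d * ∏ i, x i ^ d i)
  · intro d _ hd
    rw [MvPolynomial.notMem_support_iff.1 hd, zero_mul]

instance (n : ℕ) : IsFiniteMeasure (sphMeasure n) := by
  unfold sphMeasure; infer_instance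

lemma sph_ne (n : ℕ) (hn : 2 ≤ n) : sphMeasure n ≠ 0 := by
  have : Nonempty (Fin n) := ⟨⟨0, by omega⟩⟩
  unfold sphMeasure
  rw [Ne, Measure.map_eq_zero_iff (by fun_prop)]
  exact Measure.toSphere_ne_zero _

lemma sph_real_ne (n : ℕ) (hn : 2 ≤ n) : (sphMeasure n).real Set.univ ≠ 0 := by
  have : NeZero (sphMeasure n) := ⟨sph_ne n hn⟩
  exact measureReal_univ_ne_zero

lemma sph_ae (n : ℕ) : ∀ᵐ x ∂(sphMeasure n), x ∈ sphere (0 : E n) 1 := by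
  unfold sphMeasure
  refine (ae_map_iff (p := fun x : E n => x ∈ sphere (0 : E n) 1) (by fun_prop)
    (isClosed_sphere.measurableSet)).2 ?_
  exact Filter.Eventually.of_forall (fun x => x.2)

def mom (n m : ℕ) : Idx n m → ℝ := ⨍ x, Phi n m x ∂(sphMeasure n)

lemma Phi_int (n m : ℕ) : Integrable (Phi n m) (sphMeasure n) := by
  refine Integrable.of_bound (C := 1) (Phi_cont n m).aestronglyMeasurable ?_
  filter_upwards [sph_ae n] with x hx
  rw [pi_norm_le_iff_of_nonneg zero_le_one]
  exact Phi_le n m x hx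

lemma mom_apply (n m : ℕ) (hn : 2 ≤ n) (a : Idx n m) :
    (sphMeasure n).real Set.univ * mom n m a = ∫ x, Phi n m x a ∂(sphMeasure n) := by
  unfold mom
  have h := (ContinuousLinearMap.proj (R := ℝ) (φ := fun _ : Idx n m => ℝ) a).integral_comp_comm
    (Phi_int n m)
  simp only [ContinuousLinearMap.proj_apply] at h
  rw [h, average_eq]
  have : (sphMeasure n).real Set.univ ≠ 0 := by
    exact sph_real_ne n hn
  simp only [Pi.smul_apply, smul_eq_mul]
  field_simp

lemma exists_quad (n m : ℕ) (hn : 2 ≤ n) : ∃ (N : ℕ) (x : Fin N → E n) (w : Fin N → ℝ),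
    (∀ i, x i ∈ sphere (0 : E n) 1) ∧ (∀ i, 0 ≤ w i) ∧ ∑ i, w i • Phi n m (x i) = mom n m := by
  have : NeZero (sphMeasure n) := ⟨sph_ne n hn⟩
  have hK : IsCompact (convexHull ℝ (Phi n m '' sphere (0 : E n) 1)) :=
    isCompact_convexHull_fd ((isCompact_sphere _ _).image (Phi_cont n m))
  have h : mom n m ∈ convexHull ℝ (Phi n m '' sphere (0 : E n) 1) := by
    refine (convex_convexHull ℝ _).average_mem hK.isClosed ?_ (Phi_int n m)
    filter_upwards [sph_ae n] with x hx
    exact subset_convexHull ℝ _ ⟨x, hx, rfl⟩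
  rw [mem_convexHull_iff_exists_fintype] at h
  obtain ⟨ι, _, w, z, hw, -, hz, hs⟩ := h
  choose y hy hyz using hz
  let e := Fintype.equivFin ι
  refine ⟨Fintype.card ι, fun i => y (e.symm i), fun i => w (e.symm i), fun i => hy _,
    fun i => hw _, ?_⟩
  rw [← hs]
  rw [← e.symm.sum_comp]
  simp [hyz]

/-- moments imply quadrature -/
lemma quad_of_mom (n m : ℕ) (hn : 2 ≤ n) {N : ℕ} (x : Fin N → E n) (w : Fin N → ℝ)
    (h : ∑ i, w i • Phi n m (x i) = mom n m) :
    (∑ i, w i) = 1 ∧ ∀ p ∈ P0 n m, (∑ i, w i * MvPolynomial.eval (fun j => x i j) p) = 0 := by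
  have hr : (sphMeasure n).real Set.univ ≠ 0 := sph_real_ne n hn
  have ha : ∀ a, ∑ i, w i * Phi n m (x i) a = mom n m a := by
    intro a
    rw [← h]; simp
  constructor
  · have h0 := ha ⟨0, by simp⟩
    have h1 := mom_apply n m hn ⟨0, by simp⟩
    simp only [Phi, Finsupp.coe_zero, Pi.zero_apply, pow_zero, Finset.prod_const_one, mul_one,
      integral_const, smul_eq_mul] at h0 h1
    rw [h0]
    exact mul_left_cancel₀ hr (by rw [h1, mul_one])
  · rintro p ⟨hp, hi⟩
    simp only [eval_Phi n m p hp] at hi ⊢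
    rw [integral_finsetSum] at hi
    · simp only [integral_const_mul, ← mom_apply n m hn] at hi
      have : (sphMeasure n).real Set.univ * ∑ a : Idx n m, p.coeff a.1 * mom n m a = 0 := by
        rw [← hi, Finset.mul_sum]
        exact Finset.sum_congr rfl fun a _ => by ring
      have h2 := (mul_eq_zero.1 this).resolve_left hr
      rw [← h2]
      simp only [← ha, Finset.mul_sum]
      rw [Finset.sum_comm]
      exact Finset.sum_congr rfl fun a _ => Finset.sum_congr rfl fun i _ => by ring
    · intro a _
      exact ((Phi_int n m).eval a).const_mul _

/-- quadrature implies moments, sequence version -/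
lemma mom_of_quad (n m : ℕ) (hn : 2 ≤ n) (ξ : ℕ → E n) (w : ℕ → ℝ)
    (hξ : ∀ i, ξ i ∈ sphere (0 : E n) 1) (hw : ∀ i, 0 ≤ w i) (hs : Summable w)
    (h1 : (∑' i, w i) = 1)
    (h : ∀ p ∈ P0 n m, (∑' i, w i * MvPolynomial.eval (fun j => ξ i j) p) = 0) (a : Idx n m) :
    HasSum (fun i => w i * Phi n m (ξ i) a) (mom n m a) := by
  have hsum : Summable (fun i => w i * Phi n m (ξ i) a) := by
    refine Summable.of_norm_bounded hs fun i => ?_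
    rw [norm_mul, Real.norm_of_nonneg (hw i)]
    exact mul_le_of_le_one_right (hw i) (Phi_le n m _ (hξ i) a)
  have hev : ∀ x : E n, MvPolynomial.eval (fun j => x j)
      (MvPolynomial.monomial a.1 1 - MvPolynomial.C (mom n m a)) = Phi n m x a - mom n m a := by
    intro x
    simp [MvPolynomial.eval_monomial, Phi, Finsupp.prod_fintype]
  have hp : (MvPolynomial.monomial a.1 1 - MvPolynomial.C (mom n m a)) ∈ P0 n m := by
    refine ⟨(MvPolynomial.totalDegree_sub_C_le _ _).trans
      ((MvPolynomial.totalDegree_monomial_le _ _).trans a.2), ?_⟩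
    simp only [hev]
    rw [integral_sub ((Phi_int n m).eval a) (integrable_const _), ← mom_apply n m hn]
    simp
  have h2 := h _ hp
  simp only [hev, mul_sub] at h2
  rw [hsum.tsum_sub (hs.mul_right _), tsum_mul_right, h1, one_mul, sub_eq_zero] at h2
  rw [← h2]
  exact hsum.hasSum

lemma Nsph_set_nonempty (n m : ℕ) (hn : 2 ≤ n) : {N : ℕ | ∃ (x : Fin N → E n) (w : Fin N → ℝ),
    (∀ i, x i ∈ Metric.sphere (0 : E n) 1) ∧ (∀ i, 0 ≤ w i) ∧ (∑ i, w i) = 1 ∧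
    ∀ p ∈ P0 n m, (∑ i, w i * MvPolynomial.eval (fun j => x i j) p) = 0}.Nonempty := by
  obtain ⟨N, x, w, hx, hw, h⟩ := exists_quad n m hn
  have := quad_of_mom n m hn x w h
  exact ⟨N, x, w, hx, hw, this.1, this.2⟩

lemma gap (n m : ℕ) (hn : 2 ≤ n) (M : ℕ) (hM : M < Nsph n m) :
    ∃ η : ℝ, 0 < η ∧ ∀ (x : Fin M → E n) (w : Fin M → ℝ), (∀ i, x i ∈ sphere (0 : E n) 1) →
      (∀ i, w i ∈ Set.Icc (0 : ℝ) 1) → η ≤ ‖(∑ i, w i • Phi n m (x i)) - mom n m‖ := by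
  have hK : IsCompact ((Set.univ.pi (fun _ : Fin M => sphere (0 : E n) 1)) ×ˢ
      (Set.univ.pi (fun _ : Fin M => Set.Icc (0 : ℝ) 1))) :=
    (isCompact_univ_pi fun _ => isCompact_sphere _ _).prod (isCompact_univ_pi fun _ => isCompact_Icc)
  have hP := Phi_cont n m
  have hc : Continuous (fun q : (Fin M → E n) × (Fin M → ℝ) =>
      ‖(∑ i, q.2 i • Phi n m (q.1 i)) - mom n m‖) := by fun_prop
  by_cases hne : ((Set.univ.pi (fun _ : Fin M => sphere (0 : E n) 1)) ×ˢ
      (Set.univ.pi (fun _ : Fin M => Set.Icc (0 : ℝ) 1))).Nonempty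
  · obtain ⟨⟨x0, w0⟩, ⟨hx0, hw0⟩, hmin⟩ := hK.exists_isMinOn hne hc.continuousOn
    refine ⟨_, ?_, fun x w hx hw => hmin (a := (x, w)) ⟨fun i _ => hx i, fun i _ => hw i⟩⟩
    rw [norm_pos_iff, sub_ne_zero]
    intro h
    have := quad_of_mom n m hn x0 w0 h
    exact Nat.notMem_of_lt_sInf hM ⟨x0, w0, fun i => hx0 i trivial, fun i => (hw0 i trivial).1,
      this.1, this.2⟩
  · refine ⟨1, one_pos, fun x w hx hw => (hne ⟨(x, w), fun i _ => hx i, fun i _ => hw i⟩).elim⟩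

lemma hasSum_fin {N : ℕ} (g : ℕ → ℝ) (h : ∀ k, N ≤ k → g k = 0) :
    HasSum g (∑ i : Fin N, g i) := by
  rw [← Finset.sum_range]
  exact hasSum_sum_of_ne_finset_zero fun k hk => h k (by simpa using hk)

def ThetaSet (n m : ℕ) (θ : ℝ) : Set ℝ := {t : ℝ | ∃ (ξ : ℕ → E n) (w : ℕ → ℝ),
    (∀ i, ξ i ∈ Metric.sphere (0 : E n) 1) ∧ (∀ i, 0 ≤ w i) ∧ Summable w ∧
    (∑' i, w i) = 1 ∧
    (∀ p ∈ P0 n m, (∑' i, w i * MvPolynomial.eval (fun j => ξ i j) p) = 0) ∧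
    Summable (fun i => w i ^ θ) ∧ t = ∑' i, w i ^ θ}

lemma upper (n m : ℕ) (hn : 2 ≤ n) (θ : ℝ) (hθ : 0 < θ) :
    ∃ t ∈ ThetaSet n m θ, t ≤ Nsph n m := by
  have hmem := Nat.sInf_mem (Nsph_set_nonempty n m hn)
  change Nsph n m ∈ _ at hmem
  obtain ⟨x, w, hx, hw, h1, hp⟩ := hmem
  generalize Nsph n m = N at x w hx hw h1 hp ⊢
  have hNpos : 0 < N := by
    rcases Nat.eq_zero_or_pos N with h0 | h0
    · have : IsEmpty (Fin N) := by rw [h0]; infer_instance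
      have h1' : (∑ i : Fin N, w i) = 1 := h1
      simp at h1'
    · exact h0
  let ξ' : ℕ → E n := fun k => if h : k < N then x ⟨k, h⟩ else x ⟨0, hNpos⟩
  let w' : ℕ → ℝ := fun k => if h : k < N then w ⟨k, h⟩ else 0
  have hξi : ∀ i : Fin N, ξ' i = x i := fun i => by simp [ξ']
  have hwi : ∀ i : Fin N, w' i = w i := fun i => by simp [w']
  have hw0 : ∀ k, N ≤ k → w' k = 0 := fun k hk => by simp [w', hk]
  have s1 := hasSum_fin w' hw0
  have s2 := hasSum_fin (N := N) (fun k => w' k ^ θ)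
    (fun k hk => by simp [hw0 k hk, Real.zero_rpow hθ.ne'])
  refine ⟨_, ⟨ξ', w', ?_, ?_, s1.summable, ?_, ?_, s2.summable, rfl⟩, ?_⟩
  · intro k
    simp only [ξ']
    split_ifs <;> exact hx _
  · intro k
    simp only [w']
    split_ifs
    · exact hw _
    · exact le_rfl
  · rw [s1.tsum_eq]
    simp only [hwi]
    exact h1
  · intro p hpm
    have s3 := hasSum_fin (N := N) (fun k => w' k * MvPolynomial.eval (fun j => ξ' k j) p)
      (fun k hk => by simp [hw0 k hk])
    rw [s3.tsum_eq]
    simp only [hwi, hξi]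
    exact hp p hpm
  · rw [s2.tsum_eq]
    simp only [hwi]
    calc ∑ i : Fin N, w i ^ θ ≤ ∑ i : Fin N, (1 : ℝ) := by
          refine Finset.sum_le_sum fun i _ => Real.rpow_le_one (hw i) ?_ hθ.le
          have h1' : (∑ i : Fin N, w i) = 1 := h1
          rw [← h1']
          exact Finset.single_le_sum (fun j _ => hw j) (Finset.mem_univ i)
      _ = N := by simp

lemma lower (n m : ℕ) (hn : 2 ≤ n) (ε : ℝ) (hε : 0 < ε) :
    ∀ᶠ θ in nhdsWithin (0 : ℝ) (Set.Ioi 0), ∀ t ∈ ThetaSet n m θ, (Nsph n m : ℝ) - ε ≤ t := by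
  rcases Nat.eq_zero_or_pos (Nsph n m) with h0 | hNpos
  · refine Filter.Eventually.of_forall fun θ t ht => ?_
    obtain ⟨ξ, w, -, hw, -, -, -, -, rfl⟩ := ht
    have : 0 ≤ ∑' i, w i ^ θ := tsum_nonneg fun i => Real.rpow_nonneg (hw i) _
    rw [h0]; push_cast; linarith
  set N := Nsph n m with hN
  have hNR : (0 : ℝ) < N := by exact_mod_cast hNpos
  obtain ⟨η, hη, hgap⟩ := gap n m hn (N - 1) (by omega)
  -- the threshold `δ = d ^ 2`
  obtain ⟨d, hd0, hd1, hdN⟩ : ∃ d : ℝ, 0 < d ∧ d < 1 ∧ d * N < η := by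
    refine ⟨min (1 / 2) (η / (2 * N)), by positivity, ?_, ?_⟩
    · exact (min_le_left _ _).trans_lt (by norm_num)
    · calc min (1 / 2) (η / (2 * N)) * N ≤ η / (2 * N) * N := by gcongr; exact min_le_right _ _
        _ = η / 2 := by field_simp
        _ < η := by linarith
  set δ : ℝ := d ^ (2 : ℝ) with hδ
  have hδ0 : 0 < δ := Real.rpow_pos_of_pos hd0 _
  have hδ1 : δ ≤ 1 := Real.rpow_le_one hd0.le hd1.le (by norm_num)
  have hlim : Filter.Tendsto (fun θ : ℝ => (N : ℝ) * δ ^ θ) (nhdsWithin 0 (Set.Ioi 0))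
      (nhds (N : ℝ)) := by
    have : ContinuousAt (fun θ : ℝ => (N : ℝ) * δ ^ θ) 0 :=
      continuousAt_const.mul (Real.continuousAt_const_rpow hδ0.ne')
    have h := this.tendsto
    simp only [Real.rpow_zero, mul_one] at h
    exact h.mono_left nhdsWithin_le_nhds
  have e1 := hlim.eventually_const_lt (show (N : ℝ) - ε < N by linarith)
  have e2 : ∀ᶠ θ in nhdsWithin (0 : ℝ) (Set.Ioi 0), θ < 1 / 2 :=
    nhdsWithin_le_nhds (Iio_mem_nhds (by norm_num))
  filter_upwards [e1, e2, self_mem_nhdsWithin] with θ h1 h2 hθ t ht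
  have hθ : 0 < θ := hθ
  by_contra! hlt
  obtain ⟨ξ, w, hξ, hw, hsw, hw1, hp, hsθ, rfl⟩ := ht
  have hδθ : 0 < δ ^ θ := Real.rpow_pos_of_pos hδ0 _
  have hfin : {i | δ ≤ w i}.Finite := by
    have := hsw.tendsto_cofinite_zero.eventually_lt_const hδ0
    simpa [Filter.eventually_cofinite] using this
  set S := hfin.toFinset with hS
  have hcard : S.card ≤ N - 1 := by
    have a1 : (S.card : ℝ) * δ ^ θ ≤ ∑' i, w i ^ θ := by
      calc (S.card : ℝ) * δ ^ θ = ∑ i ∈ S, δ ^ θ := by simp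
        _ ≤ ∑ i ∈ S, w i ^ θ := by
          refine Finset.sum_le_sum fun i hi => ?_
          have : δ ≤ w i := by simpa [hS] using hi
          exact Real.rpow_le_rpow hδ0.le this hθ.le
        _ ≤ _ := hsθ.sum_le_tsum _ fun i _ => Real.rpow_nonneg (hw i) _
    have a2 : (S.card : ℝ) < N := by
      refine lt_of_mul_lt_mul_right (a := δ ^ θ) ?_ hδθ.le
      linarith
    have : S.card < N := by exact_mod_cast a2
    omega
  obtain ⟨S', hSS, hS'⟩ := Infinite.exists_superset_card_eq S (N - 1) hcard
  let e : Fin (N - 1) ≃ S' := (S'.equivFinOfCardEq hS').symm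
  have hg := hgap (fun i => ξ (e i)) (fun i => w (e i)) (fun i => hξ _)
    (fun i => ⟨hw _, hw1 ▸ hsw.le_tsum _ fun j _ => hw j⟩)
  have hsum : ∑ i, w (e i) • Phi n m (ξ (e i)) = ∑ i ∈ S', w i • Phi n m (ξ i) := by
    rw [e.sum_comp (fun j : S' => w j • Phi n m (ξ j)),
      Finset.sum_coe_sort S' (fun j => w j • Phi n m (ξ j))]
  have hle : ‖(∑ i, w (e i) • Phi n m (ξ (e i))) - mom n m‖ ≤ d * N := by
    rw [hsum, pi_norm_le_iff_of_nonneg (by positivity)]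
    intro a
    have hm := mom_of_quad n m hn ξ w hξ hw hsw hw1 hp a
    have hf : HasSum (fun i => if i ∈ S' then w i * Phi n m (ξ i) a else 0)
        (∑ i ∈ S', w i * Phi n m (ξ i) a) := by
      have := hasSum_sum_of_ne_finset_zero (s := S') (L := SummationFilter.unconditional ℕ)
        (f := fun i => if i ∈ S' then w i * Phi n m (ξ i) a else 0) (fun i hi => by simp [hi])
      convert this using 1
      exact Finset.sum_congr rfl fun i hi => by simp [hi]
    have hdiff := hm.sub hf
    have hb := tsum_of_norm_bounded (hsθ.hasSum.mul_left d)
      (f := fun i => w i * Phi n m (ξ i) a - (if i ∈ S' then w i * Phi n m (ξ i) a else 0)) (by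
        intro i
        by_cases hi : i ∈ S'
        · simp only [hi, if_true, sub_self, norm_zero]
          exact mul_nonneg hd0.le (Real.rpow_nonneg (hw i) _)
        · simp only [hi, if_false, sub_zero, norm_mul, Real.norm_of_nonneg (hw i)]
          refine (mul_le_of_le_one_right (hw i) (Phi_le n m _ (hξ i) a)).trans ?_
          have hwδ : w i < δ := by
            by_contra! hc
            exact hi (hSS (by simpa [hS] using hc))
          calc w i = w i ^ (1 - θ) * w i ^ θ := by
                rw [← Real.rpow_add_of_nonneg (hw i) (by linarith) hθ.le]; simp
            _ ≤ d * w i ^ θ := by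
                refine mul_le_mul_of_nonneg_right ?_ (Real.rpow_nonneg (hw i) _)
                calc w i ^ (1 - θ) ≤ δ ^ (1 - θ) :=
                      Real.rpow_le_rpow (hw i) hwδ.le (by linarith)
                  _ ≤ δ ^ (1 / 2 : ℝ) :=
                      Real.rpow_le_rpow_of_exponent_ge hδ0 hδ1 (by linarith)
                  _ = d := by rw [hδ, ← Real.rpow_mul hd0.le]; norm_num)
    rw [hdiff.tsum_eq] at hb
    have : ((∑ i ∈ S', w i • Phi n m (ξ i)) - mom n m) a
        = -(mom n m a - ∑ i ∈ S', w i * Phi n m (ξ i) a) := by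
      simp
    rw [this, norm_neg]
    refine hb.trans (mul_le_mul_of_nonneg_left ?_ hd0.le)
    linarith
  linarith

theorem stmt7 (n : ℕ) (hn : 2 ≤ n) (m : ℕ) :
    Filter.Tendsto (fun θ : ℝ => Theta n m θ) (nhdsWithin 0 (Set.Ioi 0))
      (nhds (Nsph n m : ℝ)) := by
  have hT : ∀ θ, Theta n m θ = sInf (ThetaSet n m θ) := fun θ => rfl
  rw [tendsto_order]
  constructor
  · intro a ha
    filter_upwards [lower n m hn (((Nsph n m : ℝ) - a) / 2) (by linarith), self_mem_nhdsWithin]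
      with θ h hθ
    obtain ⟨t, ht, -⟩ := upper n m hn θ hθ
    have := le_csInf ⟨t, ht⟩ h
    rw [hT]
    linarith
  · intro a ha
    filter_upwards [self_mem_nhdsWithin] with θ hθ
    obtain ⟨t, ht, htN⟩ := upper n m hn θ hθ
    refine lt_of_le_of_lt ((csInf_le ⟨0, ?_⟩ ht).trans htN) ha
    rintro s ⟨ξ, w, -, hw, -, -, -, -, rfl⟩
    exact tsum_nonneg fun i => Real.rpow_nonneg (hw i) _
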